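/- arXiv:1707.01931 — 2 statements merged into one kernel-verified Lean document; each statement's English description precedes it below -/
import Mathlib

section
/- Let ρ0 be the unique positive real root of x³ + 2x² + x − 1 and let C_m be the unique real root of 31x³ − 31x² + 16x − 3 (C_m ≈ 0.32679). Then the number m_n of Dyck meanders with catastrophes of length n satisfies lim_{n→∞} m_n · ρ0ⁿ = C_m. -/
open Filter Topology

/-- Validity of a path with catastrophes over the jump set `J`, starting from
altitude `h`: each step is either a jump `s ∈ J` keeping the altitude
nonnegative, or a catastrophe `s = -h` from an altitude `h > 0` with `-h ∉ J`
(landing at altitude `0`). -/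
def CatValidFrom (J : Finset ℤ) : ℤ → List ℤ → Prop
  | _, [] => True
  | h, s :: r =>
    ((s ∈ J ∧ 0 ≤ h + s) ∨ (s = -h ∧ 0 < h ∧ -h ∉ J)) ∧ CatValidFrom J (h + s) r

/-- The jump set of Dyck paths. For this jump set a catastrophe is a jump
`-h` from an altitude `h ≥ 2` to altitude `0`. -/
def dyckJ : Finset ℤ := {-1, 1}

/-- `l` is a Dyck meander with catastrophes of length `n` (endpoint at any
altitude). -/
def DyckCatMeander (n : ℕ) (l : List ℤ) : Prop :=
  l.length = n ∧ CatValidFrom dyckJ 0 l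

/-- The number `m n` of Dyck meanders with catastrophes of length `n`. -/
noncomputable def mCount (n : ℕ) : ℕ := Nat.card {l : List ℤ // DyckCatMeander n l}

/-- The generating function of Dyck excursions, counted by length. -/
noncomputable def dyckSeries : PowerSeries ℝ :=
  PowerSeries.expand 2 two_ne_zero
    (PowerSeries.map (Nat.castRingHom ℝ) PowerSeries.catalanSeries)

namespace dyckSeries

open PowerSeries

theorem eq_one_add : dyckSeries = 1 + X ^ 2 * dyckSeries ^ 2 := by
  have h := congrArg (fun f => expand 2 two_ne_zero (map (Nat.castRingHom ℝ) f))
    catalanSeries_sq_mul_X_add_one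
  simp only [map_add, map_mul, map_pow, map_one, expand_X, map_X] at h
  rw [dyckSeries]
  linear_combination -h

theorem coeff_nonneg (n : ℕ) : 0 ≤ coeff n dyckSeries := by
  rw [dyckSeries]
  by_cases h : 2 ∣ n
  · obtain ⟨m, rfl⟩ := h
    rw [coeff_expand_mul]
    simp
  · rw [coeff_expand_of_not_dvd _ _ _ h]

theorem coeff_zero : coeff 0 dyckSeries = 1 := by
  rw [eq_one_add]
  simp

theorem coeff_one : coeff 1 dyckSeries = 0 := by
  rw [eq_one_add, map_add, coeff_X_pow_mul']
  simp [PowerSeries.coeff_one]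

theorem coeff_add_two (n : ℕ) : coeff (n + 2) dyckSeries =
    ∑ p ∈ Finset.HasAntidiagonal.antidiagonal n, coeff p.1 dyckSeries * coeff p.2 dyckSeries := by
  conv_lhs => rw [eq_one_add, map_add, coeff_X_pow_mul, sq, coeff_mul]
  simp [PowerSeries.coeff_one]

variable {x : ℝ}

theorem sum_range_add_two (x : ℝ) (N : ℕ) :
    ∑ n ∈ Finset.range (N + 2), coeff n dyckSeries * x ^ n =
      1 + x ^ 2 * ∑ n ∈ Finset.range N, ∑ p ∈ Finset.HasAntidiagonal.antidiagonal n,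
        (coeff p.1 dyckSeries * x ^ p.1) * (coeff p.2 dyckSeries * x ^ p.2) := by
  rw [Finset.sum_range_succ', Finset.sum_range_succ', zero_add, coeff_zero, coeff_one,
    Finset.mul_sum, zero_mul, add_zero, pow_zero, mul_one, add_comm]
  congr 1
  refine Finset.sum_congr rfl fun n _ => ?_
  rw [coeff_add_two, Finset.mul_sum, Finset.sum_mul]
  refine Finset.sum_congr rfl fun p hp => ?_
  rw [Finset.HasAntidiagonal.mem_antidiagonal] at hp
  rw [← hp]
  ring

theorem sum_range_add_two_le (hx : 0 ≤ x) (N : ℕ) :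
    ∑ n ∈ Finset.range (N + 2), coeff n dyckSeries * x ^ n ≤
      1 + x ^ 2 * (∑ n ∈ Finset.range N, coeff n dyckSeries * x ^ n) ^ 2 := by
  have h0 (n : ℕ) : 0 ≤ coeff n dyckSeries * x ^ n :=
    mul_nonneg (coeff_nonneg n) (pow_nonneg hx n)
  rw [sum_range_add_two]
  gcongr
  simp only [Finset.Nat.sum_antidiagonal_eq_sum_range_succ_mk]
  rw [Finset.sum_range_diag_flip N fun i j =>
    (coeff i dyckSeries * x ^ i) * (coeff j dyckSeries * x ^ j), sq, Finset.sum_mul_sum]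
  refine Finset.sum_le_sum fun i _ => Finset.sum_le_sum_of_subset_of_nonneg
    (Finset.range_mono (Nat.sub_le _ _)) fun j _ _ => mul_nonneg (h0 i) (h0 j)

theorem sum_range_le {s : ℝ} (hx : 0 ≤ x) (hs : 1 + x ^ 2 * s ^ 2 = s) (N : ℕ) :
    ∑ n ∈ Finset.range N, coeff n dyckSeries * x ^ n ≤ s := by
  have h1 : 1 ≤ s := by nlinarith [sq_nonneg (x * s)]
  induction N using Nat.twoStepInduction with
  | zero => simpa using zero_le_one.trans h1
  | one => simpa [coeff_zero] using h1
  | more N ih _ =>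
    have h0 : 0 ≤ ∑ n ∈ Finset.range N, coeff n dyckSeries * x ^ n :=
      Finset.sum_nonneg fun n _ => mul_nonneg (coeff_nonneg n) (pow_nonneg hx n)
    refine (sum_range_add_two_le hx N).trans ?_
    conv_rhs => rw [← hs]
    gcongr

/-- The Dyck series converges at `x ≥ 0` to the smaller root `s` of `1 + x² s² = s`. -/
theorem hasSum {s : ℝ} (hx : 0 ≤ x) (hs : 1 + x ^ 2 * s ^ 2 = s) (hlt : 2 * x ^ 2 * s < 1) :
    HasSum (fun n => coeff n dyckSeries * x ^ n) s := by
  have h0 (n : ℕ) : 0 ≤ coeff n dyckSeries * x ^ n :=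
    mul_nonneg (coeff_nonneg n) (pow_nonneg hx n)
  have hsum : Summable fun n => coeff n dyckSeries * x ^ n :=
    summable_of_sum_range_le h0 (sum_range_le hx hs)
  set t := ∑' n, coeff n dyckSeries * x ^ n with ht
  have hle : t ≤ s := hsum.tsum_le_of_sum_range_le (sum_range_le hx hs)
  have hquad : t = 1 + x ^ 2 * t ^ 2 := by
    have hprod := (summable_norm_sum_mul_antidiagonal_of_summable_norm hsum.norm
      hsum.norm).of_norm
    have h2 := tsum_mul_tsum_eq_tsum_sum_antidiagonal_of_summable_norm hsum.norm hsum.norm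
    have hlim := ((hprod.hasSum.tendsto_sum_nat).const_mul (x ^ 2)).const_add 1
    rw [← h2, ← ht, ← sq] at hlim
    refine tendsto_nhds_unique
      ((tendsto_add_atTop_iff_nat 2).2 hsum.hasSum.tendsto_sum_nat) (hlim.congr fun N => ?_)
    rw [sum_range_add_two]
  have : (s - t) * (1 - x ^ 2 * (s + t)) = 0 := by linear_combination -hs - hquad
  have hst : s = t := by
    rcases mul_eq_zero.1 this with h | h
    · linarith
    · nlinarith [mul_le_mul_of_nonneg_left hle (sq_nonneg x)]
  rw [hst]
  exact hsum.hasSum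

end dyckSeries

/-- The number of paths with catastrophes of length `k` starting from altitude `h`. -/
def catCount : ℕ → ℕ → ℕ
  | 0, _ => 1
  | k + 1, 0 => catCount k 1
  | k + 1, 1 => catCount k 2 + catCount k 0
  | k + 1, h + 2 => catCount k (h + 3) + catCount k (h + 1) + catCount k 0

/-- The set of valid paths of length `k` starting from altitude `h`. -/
def catPaths (k : ℕ) (h : ℤ) : Set (List ℤ) :=
  {l | l.length = k ∧ CatValidFrom dyckJ h l}

theorem catPaths_zero (h : ℤ) : catPaths 0 h = {[]} := by
  ext l
  simp only [catPaths, Set.mem_ofPred_eq, List.length_eq_zero_iff, Set.mem_singleton_iff]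
  constructor
  · exact fun hl => hl.1
  · rintro rfl
    exact ⟨rfl, trivial⟩

theorem mem_catPaths_succ {k : ℕ} {h : ℤ} {l : List ℤ} :
    l ∈ catPaths (k + 1) h ↔ ∃ s r, l = s :: r ∧
      ((s ∈ dyckJ ∧ 0 ≤ h + s) ∨ (s = -h ∧ 0 < h ∧ -h ∉ dyckJ)) ∧ r ∈ catPaths k (h + s) := by
  cases l with
  | nil => simp [catPaths]
  | cons s r =>
    simp only [catPaths, Set.mem_ofPred_eq, List.length_cons, add_left_inj, CatValidFrom,
      List.cons.injEq]
    constructor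
    · rintro ⟨h1, h2, h3⟩
      exact ⟨s, r, ⟨rfl, rfl⟩, h2, h1, h3⟩
    · rintro ⟨_, _, ⟨rfl, rfl⟩, h2, h1, h3⟩
      exact ⟨h1, h2, h3⟩

theorem catPaths_succ_zero (k : ℕ) :
    catPaths (k + 1) 0 = List.cons 1 '' catPaths k 1 := by
  ext l
  rw [mem_catPaths_succ]
  simp only [dyckJ, Finset.mem_insert, Finset.mem_singleton, Set.mem_image]
  constructor
  · rintro ⟨s, r, rfl, h, hr⟩
    obtain rfl : s = 1 := by omega
    exact ⟨r, by simpa using hr, rfl⟩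
  · rintro ⟨r, hr, rfl⟩
    exact ⟨1, r, rfl, by omega, by simpa using hr⟩

theorem catPaths_succ_one (k : ℕ) :
    catPaths (k + 1) 1 = List.cons 1 '' catPaths k 2 ∪ List.cons (-1) '' catPaths k 0 := by
  ext l
  rw [mem_catPaths_succ]
  simp only [dyckJ, Finset.mem_insert, Finset.mem_singleton, Set.mem_image, Set.mem_union]
  constructor
  · rintro ⟨s, r, rfl, h, hr⟩
    obtain rfl | rfl : s = 1 ∨ s = -1 := by omega
    · exact Or.inl ⟨r, by simpa using hr, rfl⟩
    · exact Or.inr ⟨r, by simpa using hr, rfl⟩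
  · rintro (⟨r, hr, rfl⟩ | ⟨r, hr, rfl⟩)
    · exact ⟨1, r, rfl, by omega, by simpa using hr⟩
    · exact ⟨-1, r, rfl, by omega, by simpa using hr⟩

theorem catPaths_succ_of_two_le (k : ℕ) {h : ℤ} (hh : 2 ≤ h) :
    catPaths (k + 1) h = (List.cons 1 '' catPaths k (h + 1) ∪
      List.cons (-1) '' catPaths k (h - 1)) ∪ List.cons (-h) '' catPaths k 0 := by
  ext l
  rw [mem_catPaths_succ]
  simp only [dyckJ, Finset.mem_insert, Finset.mem_singleton, Set.mem_image, Set.mem_union]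
  constructor
  · rintro ⟨s, r, rfl, h', hr⟩
    obtain rfl | rfl | rfl : s = 1 ∨ s = -1 ∨ s = -h := by omega
    · exact Or.inl (Or.inl ⟨r, hr, rfl⟩)
    · exact Or.inl (Or.inr ⟨r, hr, rfl⟩)
    · exact Or.inr ⟨r, by simpa using hr, rfl⟩
  · rintro ((⟨r, hr, rfl⟩ | ⟨r, hr, rfl⟩) | ⟨r, hr, rfl⟩)
    · exact ⟨1, r, rfl, by omega, hr⟩
    · exact ⟨-1, r, rfl, by omega, hr⟩
    · exact ⟨-h, r, rfl, by omega, by simpa using hr⟩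

theorem disjoint_cons_image {s t : ℤ} (hst : s ≠ t) (A B : Set (List ℤ)) :
    Disjoint (List.cons s '' A) (List.cons t '' B) := by
  rw [Set.disjoint_left]
  rintro _ ⟨a, _, rfl⟩ ⟨b, _, hb⟩
  exact hst (List.cons.inj hb).1.symm

theorem ncard_cons_image (s : ℤ) (A : Set (List ℤ)) : (List.cons s '' A).ncard = A.ncard :=
  Set.ncard_image_of_injective A List.cons_injective

theorem catPaths_finite_ncard (k h : ℕ) :
    (catPaths k h).Finite ∧ (catPaths k h).ncard = catCount k h := by
  induction k generalizing h with
  | zero => simp [catPaths_zero, catCount]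
  | succ k ih =>
    have h0 := ih 0
    rw [Nat.cast_zero] at h0
    match h with
    | 0 =>
      have h1 := ih 1
      rw [Nat.cast_one] at h1
      rw [Nat.cast_zero, catPaths_succ_zero, ncard_cons_image]
      exact ⟨h1.1.image _, h1.2⟩
    | 1 =>
      have h2 := ih 2
      rw [Nat.cast_ofNat] at h2
      rw [Nat.cast_one, catPaths_succ_one,
        Set.ncard_union_eq (disjoint_cons_image (by norm_num) _ _) (h2.1.image _) (h0.1.image _),
        ncard_cons_image, ncard_cons_image, h2.2, h0.2]
      exact ⟨(h2.1.image _).union (h0.1.image _), rfl⟩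
    | h + 2 =>
      have hu := ih (h + 3)
      have hd := ih (h + 1)
      rw [show ((h + 3 : ℕ) : ℤ) = ((h + 2 : ℕ) : ℤ) + 1 by push_cast; ring] at hu
      rw [show ((h + 1 : ℕ) : ℤ) = ((h + 2 : ℕ) : ℤ) - 1 by push_cast; ring] at hd
      have hfin := (hu.1.image (List.cons 1)).union (hd.1.image (List.cons (-1)))
      rw [catPaths_succ_of_two_le k (by omega),
        Set.ncard_union_eq (Set.disjoint_union_left.2
          ⟨disjoint_cons_image (by omega) _ _, disjoint_cons_image (by omega) _ _⟩)
          hfin (h0.1.image _),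
        Set.ncard_union_eq (disjoint_cons_image (by norm_num) _ _) (hu.1.image _) (hd.1.image _),
        ncard_cons_image, ncard_cons_image, ncard_cons_image, hu.2, hd.2, h0.2]
      exact ⟨hfin.union (h0.1.image _), rfl⟩

theorem mCount_eq_catCount (n : ℕ) : mCount n = catCount n 0 := by
  rw [← (catPaths_finite_ncard n 0).2, ← Nat.card_coe_set_eq]
  rfl

section GeneratingFunction

open PowerSeries

/-- A family of power series solving the first-step equations is the family of generating
functions of the paths with catastrophes, indexed by the initial altitude. -/
theorem coeff_eq_catCount {S : ℕ → PowerSeries ℝ} (h0 : S 0 = 1 + X * S 1)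
    (h1 : S 1 = 1 + X * (S 2 + S 0))
    (h2 : ∀ h, S (h + 2) = 1 + X * (S (h + 3) + S (h + 1) + S 0)) (k h : ℕ) :
    coeff k (S h) = catCount k h := by
  induction k generalizing h with
  | zero =>
    match h with
    | 0 => rw [h0]; simp [catCount]
    | 1 => rw [h1]; simp [catCount]
    | h + 2 => rw [h2]; simp [catCount]
  | succ k ih =>
    match h with
    | 0 => rw [h0, map_add, coeff_succ_X_mul, ih]; simp [catCount, PowerSeries.coeff_one]
    | 1 =>
      rw [h1, map_add, coeff_succ_X_mul, map_add, ih, ih]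
      simp [catCount, PowerSeries.coeff_one]
    | h + 2 =>
      rw [h2, map_add, coeff_succ_X_mul, map_add, map_add, ih, ih, ih]
      simp [catCount, PowerSeries.coeff_one]

theorem mk_mCount_mul :
    (PowerSeries.mk fun n => (mCount n : ℝ)) * (1 - X - 2 * X ^ 2 - X ^ 3) =
      1 - X ^ 2 * (1 + X) * dyckSeries := by
  have hE := dyckSeries.eq_one_add
  set E := dyckSeries
  obtain ⟨I, hI⟩ : ∃ I : PowerSeries ℝ, (1 - 2 * X) * I = 1 :=
    ⟨_, PowerSeries.mul_inv_cancel _ (by simp)⟩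
  obtain ⟨D, hD⟩ : ∃ D : PowerSeries ℝ, (1 - X - 2 * X ^ 2 - X ^ 3) * D = 1 :=
    ⟨_, PowerSeries.mul_inv_cancel _ (by simp)⟩
  set M := (1 - X ^ 2 * (1 + X) * E) * D with hM
  have hMD : M * (1 - X - 2 * X ^ 2 - X ^ 3) = 1 - X ^ 2 * (1 + X) * E := by
    rw [hM]
    linear_combination (1 - X ^ 2 * (1 + X) * E) * hD
  set P := (1 + X * M) * I with hP
  have hPI : P * (1 - 2 * X) = 1 + X * M := by
    rw [hP]
    linear_combination (1 + X * M) * hI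
  have hy : X * E = X * (1 + (X * E) ^ 2) := by linear_combination X * hE
  have hM0 : M = 1 + X * (P * (1 - X * E)) := by
    have key : (1 - X - 2 * X ^ 2 - X ^ 3) * (1 - 2 * X) *
        (M - (1 + X * (P * (1 - X * E)))) = 0 := by
      linear_combination (-(X * (1 - X * E) * (1 - X - 2 * X ^ 2 - X ^ 3))) * hPI +
        (1 - 2 * X - X ^ 2 * (1 - X * E)) * hMD + (X ^ 3 + X ^ 4) * hE
    have := congrArg (fun f => I * D * f) key
    simp only [mul_zero] at this
    linear_combination this + (-(1 - 2 * X) * I * (M - (1 + X * (P * (1 - X * E))))) * hD -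
      (M - (1 + X * (P * (1 - X * E)))) * hI
  let S : ℕ → PowerSeries ℝ := fun h => if h = 0 then M else P * (1 - (X * E) ^ h)
  have hS (n : ℕ) : coeff n M = mCount n := by
    rw [mCount_eq_catCount]
    refine coeff_eq_catCount (S := S) ?_ ?_ (fun h => ?_) n 0
    · simpa [S] using hM0
    · simp only [S, if_true, one_ne_zero, if_false, two_ne_zero]
      linear_combination hPI - P * hy
    · simp only [S, if_true, Nat.add_eq_zero_iff, OfNat.ofNat_ne_zero, one_ne_zero, and_false,
        if_false]
      linear_combination hPI - P * (X * E) ^ (h + 1) * hy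
  rw [← hMD]
  congr 1
  ext n
  rw [coeff_mk, hS]

end GeneratingFunction

theorem mCount_zero : mCount 0 = 1 := by simp [mCount_eq_catCount, catCount]

theorem mCount_one : mCount 1 = 1 := by simp [mCount_eq_catCount, catCount]

theorem mCount_two : mCount 2 = 2 := by simp [mCount_eq_catCount, catCount]

theorem mCount_add_three (n : ℕ) :
    (mCount (n + 3) : ℝ) = mCount (n + 2) + 2 * mCount (n + 1) + mCount n -
      (PowerSeries.coeff (n + 1) dyckSeries + PowerSeries.coeff n dyckSeries) := by
  have h := congrArg (PowerSeries.coeff (n + 3)) mk_mCount_mul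
  set M := PowerSeries.mk fun n => (mCount n : ℝ) with hM
  have hc (k : ℕ) : PowerSeries.coeff k M = mCount k := PowerSeries.coeff_mk _ _
  open PowerSeries in
  rw [show M * (1 - X - 2 * X ^ 2 - X ^ 3) =
      M - X ^ 1 * M - (X ^ 2 * M + X ^ 2 * M) - X ^ 3 * M by ring,
    show (1 - X ^ 2 * (1 + X) * dyckSeries : PowerSeries ℝ) =
      1 - (X ^ 2 * dyckSeries + X ^ 3 * dyckSeries) by ring] at h
  simp only [map_sub, map_add] at h
  rw [PowerSeries.coeff_X_pow_mul M 3 n, PowerSeries.coeff_X_pow_mul M 2 (n + 1),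
    PowerSeries.coeff_X_pow_mul M 1 (n + 2), PowerSeries.coeff_X_pow_mul dyckSeries 3 n,
    PowerSeries.coeff_X_pow_mul dyckSeries 2 (n + 1), PowerSeries.coeff_one, if_neg (by omega),
    hc, hc, hc, hc] at h
  linear_combination h

theorem tendsto_zero_of_le_mul_add {w ε : ℕ → ℝ} {θ : ℝ} (hw : ∀ n, 0 ≤ w n) (hθ0 : 0 ≤ θ)
    (hθ1 : θ < 1) (hε : Tendsto ε atTop (𝓝 0)) (h : ∀ n, w (n + 1) ≤ θ * w n + ε n) :
    Tendsto w atTop (𝓝 0) := by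
  have hθ : 0 < 1 - θ := sub_pos.2 hθ1
  rw [Metric.tendsto_atTop]
  intro δ hδ
  obtain ⟨N, hN⟩ := eventually_atTop.1
    (hε.eventually_lt_const (u := δ / 2 * (1 - θ)) (by positivity))
  have hk (k : ℕ) : w (N + k) ≤ θ ^ k * w N + δ / 2 := by
    induction k with
    | zero => simp only [add_zero, pow_zero, one_mul]; linarith
    | succ k ih =>
      have h1 := h (N + k)
      have h2 := hN (N + k) (by omega)
      have h3 := mul_le_mul_of_nonneg_left ih hθ0
      rw [← add_assoc, pow_succ]
      linarith
  have hlim : Tendsto (fun k => θ ^ k * w N) atTop (𝓝 0) := by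
    simpa using (tendsto_pow_atTop_nhds_zero_of_lt_one hθ0 hθ1).mul_const (w N)
  obtain ⟨K, hK⟩ := eventually_atTop.1 (hlim.eventually_lt_const (half_pos hδ))
  refine ⟨N + K, fun n hn => ?_⟩
  obtain ⟨k, rfl⟩ := Nat.exists_eq_add_of_le (show N ≤ n by omega)
  rw [Real.dist_eq, sub_zero, abs_of_nonneg (hw _)]
  linarith [hk k, hK k (by omega)]

/-- A sequence tends to zero as soon as a linear combination of three consecutive terms does,
provided its leading coefficient dominates in a suitable weighted sense. -/
theorem tendsto_zero_of_add_mul_add_mul {a : ℕ → ℝ} {p q c θ : ℝ} (hp : 0 ≤ p) (hq : 0 ≤ q)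
    (hc : 0 ≤ c) (hθ1 : θ < 1) (hpc : p + c ≤ θ) (hqc : q ≤ θ * c)
    (h : Tendsto (fun n => a (n + 2) + p * a (n + 1) + q * a n) atTop (𝓝 0)) :
    Tendsto a atTop (𝓝 0) := by
  have hw : Tendsto (fun n => |a (n + 1)| + c * |a n|) atTop (𝓝 0) := by
    refine tendsto_zero_of_le_mul_add (fun n => by positivity) (by linarith) hθ1
      (tendsto_zero_iff_abs_tendsto_zero _ |>.1 h) fun n => ?_
    have h1 : |a (n + 2)| ≤
        |a (n + 2) + p * a (n + 1) + q * a n| + p * |a (n + 1)| + q * |a n| := by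
      calc |a (n + 2)| = |(a (n + 2) + p * a (n + 1) + q * a n) - p * a (n + 1) - q * a n| := by
            congr 1; ring
        _ ≤ |a (n + 2) + p * a (n + 1) + q * a n| + |p * a (n + 1)| + |q * a n| :=
            (abs_sub _ _).trans (by gcongr; exact abs_sub _ _)
        _ = _ := by rw [abs_mul, abs_mul, abs_of_nonneg hp, abs_of_nonneg hq]
    have h2 := mul_le_mul_of_nonneg_right hpc (abs_nonneg (a (n + 1)))
    have h3 := mul_le_mul_of_nonneg_right hqc (abs_nonneg (a n))
    simp only [Function.comp_apply]
    linarith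
  rw [← tendsto_add_atTop_iff_nat 1, tendsto_zero_iff_abs_tendsto_zero]
  exact squeeze_zero (fun n => abs_nonneg _)
    (fun n => le_add_of_nonneg_right (mul_nonneg hc (abs_nonneg (a n)))) hw

/-- A shifted partial-fraction combination of the rescaled counts, whose increments are
explicit. -/
theorem mCount_combination_eq {ρ : ℝ} (hρ : ρ ^ 3 + 2 * ρ ^ 2 + ρ - 1 = 0) (n : ℕ) :
    mCount (n + 2) * ρ ^ (n + 2) + (1 - ρ) * (mCount (n + 1) * ρ ^ (n + 1)) +
      ρ ^ 3 * (mCount n * ρ ^ n) =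
    ρ + ρ ^ 2 + ρ ^ 3 - ρ ^ 2 * ∑ k ∈ Finset.range n,
        PowerSeries.coeff (k + 1) dyckSeries * ρ ^ (k + 1) -
      ρ ^ 3 * ∑ k ∈ Finset.range n, PowerSeries.coeff k dyckSeries * ρ ^ k := by
  induction n with
  | zero =>
    simp only [zero_add, mCount_zero, mCount_one, mCount_two, Finset.range_zero,
      Finset.sum_empty]
    push_cast
    ring
  | succ n ih =>
    rw [Finset.sum_range_succ, Finset.sum_range_succ]
    have hrec := mCount_add_three n
    linear_combination ih + ρ ^ (n + 3) * hrec +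
      mCount (n + 1) * ρ ^ (n + 1) * hρ

theorem tendsto_mCount_mul_pow {ρ : ℝ} (hpos : 0 < ρ)
    (hρ : ρ ^ 3 + 2 * ρ ^ 2 + ρ - 1 = 0) :
    Tendsto (fun n : ℕ => (mCount n : ℝ) * ρ ^ n) atTop (𝓝 ((1 - ρ) / (2 - ρ + ρ ^ 3))) := by
  have hlt : ρ < 1 / 2 := by
    by_contra! h
    nlinarith [pow_le_pow_left₀ (by norm_num) h 2, pow_le_pow_left₀ (by norm_num) h 3]
  have hden : 0 < 2 - ρ + ρ ^ 3 := by nlinarith [pow_pos hpos 3]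
  have hsq : ρ ^ 2 < 1 / 4 := by nlinarith
  have hE : HasSum (fun n => PowerSeries.coeff n dyckSeries * ρ ^ n) (1 + ρ) :=
    dyckSeries.hasSum hpos.le (by linear_combination ρ * hρ) (by nlinarith)
  have hE' : HasSum (fun n => PowerSeries.coeff (n + 1) dyckSeries * ρ ^ (n + 1)) ρ := by
    rw [hasSum_nat_add_iff' 1 |>.symm] at hE
    simpa [dyckSeries.coeff_zero] using hE
  set L := (1 - ρ) / (2 - ρ + ρ ^ 3) with hL
  have hLe : L * (2 - ρ + ρ ^ 3) = 1 - ρ := div_mul_cancel₀ _ hden.ne'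
  have hlim := ((hE'.tendsto_sum_nat.const_mul (ρ ^ 2)).const_sub (ρ + ρ ^ 2 + ρ ^ 3)).sub
    (hE.tendsto_sum_nat.const_mul (ρ ^ 3)) |>.sub_const (L * (2 - ρ + ρ ^ 3))
  rw [show ρ + ρ ^ 2 + ρ ^ 3 - ρ ^ 2 * ρ - ρ ^ 3 * (1 + ρ) - L * (2 - ρ + ρ ^ 3) = 0 by
    linear_combination -hLe + (1 - ρ) * hρ] at hlim
  rw [← tendsto_sub_nhds_zero_iff]
  refine tendsto_zero_of_add_mul_add_mul (p := 1 - ρ) (q := ρ ^ 3) (c := ρ / 2)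
    (θ := 1 - ρ / 2) (by linarith) (by positivity) (by positivity) (by linarith) (by linarith)
    (by nlinarith) (hlim.congr fun n => ?_)
  rw [← mCount_combination_eq hρ]
  ring

/-- **Asymptotics of Dyck meanders with catastrophes.** If `ρ0` is the (unique)
positive real root of `x³ + 2x² + x - 1` and `Cₘ` is the (unique) real root of
`31x³ - 31x² + 16x - 3` (`Cₘ ≈ 0.32679`), then `m_n · ρ0ⁿ → Cₘ`. -/
theorem mCount_asymptotics (ρ0 Cm : ℝ) (hρ0pos : 0 < ρ0)
    (hρ0 : ρ0 ^ 3 + 2 * ρ0 ^ 2 + ρ0 - 1 = 0)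
    (hCm : 31 * Cm ^ 3 - 31 * Cm ^ 2 + 16 * Cm - 3 = 0) :
    Tendsto (fun n : ℕ => (mCount n : ℝ) * ρ0 ^ n) atTop (𝓝 Cm) := by
  have hlt : ρ0 < 1 := by nlinarith [pow_pos hρ0pos 3, pow_pos hρ0pos 2]
  have hden : 2 - ρ0 + ρ0 ^ 3 ≠ 0 := by nlinarith [pow_pos hρ0pos 3]
  have key : (1 - ρ0) / (2 - ρ0 + ρ0 ^ 3) = Cm := by
    set L := (1 - ρ0) / (2 - ρ0 + ρ0 ^ 3) with hL
    have hroot : 31 * L ^ 3 - 31 * L ^ 2 + 16 * L - 3 = 0 := by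
      rw [hL]
      field_simp
      linear_combination (-9 + 21 * ρ0 - 28 * ρ0 ^ 2 + 21 * ρ0 ^ 3 - 16 * ρ0 ^ 4 + 6 * ρ0 ^ 5 -
        3 * ρ0 ^ 6) * hρ0
    have hmul : (L - Cm) * (31 * (L ^ 2 + L * Cm + Cm ^ 2) - 31 * (L + Cm) + 16) = 0 := by
      linear_combination hroot - hCm
    have hpos : 0 < 31 * (L ^ 2 + L * Cm + Cm ^ 2) - 31 * (L + Cm) + 16 := by
      nlinarith [sq_nonneg (L - Cm), sq_nonneg (L + Cm - 2 / 3)]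
    linarith [(mul_eq_zero.1 hmul).resolve_right hpos.ne']
  rw [← key]
  exact tendsto_mCount_mul_pow hρ0pos hρ0
end

section
/- Let μ be the unique real root of 31μ³ + 31μ² + 40μ − 3 (μ ≈ 0.0708358) and let σ > 0 be the unique positive real root of 29791σ⁶ − 59582σ⁴ + 60579σ² − 2927 (σ² ≈ 0.0507898). Then the number of catastrophes of a uniformly random Dyck path with catastrophes of length n is asymptotically Gaussian: for every real x, the fraction of Dyck paths with catastrophes of length n whose number of catastrophes is at most μn + σ√n·x tends, as n → ∞, to Φ(x) = (2π)^{−1/2} ∫_{−∞}^{x} e^{−t²/2} dt. -/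
open Filter Topology

/-- The number of catastrophe steps of a path starting at altitude `h`. -/
def catNum (J : Finset ℤ) : ℤ → List ℤ → ℕ
  | _, [] => 0
  | h, s :: r => (if s = -h ∧ 0 < h ∧ -h ∉ J then 1 else 0) + catNum J (h + s) r

/-- `l` is a Dyck path with catastrophes of length `n`. -/
def DyckCat (n : ℕ) (l : List ℤ) : Prop :=
  l.length = n ∧ CatValidFrom dyckJ 0 l ∧ l.sum = 0

/-- The number `e n` of Dyck paths with catastrophes of length `n`. -/
noncomputable def eCount (n : ℕ) : ℕ := Nat.card {l : List ℤ // DyckCat n l}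

/-- The standard Gaussian cumulative distribution function
`Φ(x) = (2π)^{-1/2} ∫_{-∞}^{x} e^{-t²/2} dt`. -/
noncomputable def gaussianCDF (x : ℝ) : ℝ :=
  (Real.sqrt (2 * Real.pi))⁻¹ * ∫ t in Set.Iic x, Real.exp (-t ^ 2 / 2)

/-- The Dyck suffixes with catastrophes: the valid paths of length `n` that start at altitude `h`
and end at altitude `0`. -/
def dyckSuffixes : ℕ → ℕ → Finset (List ℤ)
  | 0, 0 => {[]}
  | 0, _ + 1 => ∅
  | n + 1, 0 => (dyckSuffixes n 1).image (List.cons 1)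
  | n + 1, 1 => (dyckSuffixes n 2).image (List.cons 1) ∪ (dyckSuffixes n 0).image (List.cons (-1))
  | n + 1, h + 2 => ((dyckSuffixes n (h + 3)).image (List.cons 1) ∪
      (dyckSuffixes n (h + 1)).image (List.cons (-1))) ∪
      (dyckSuffixes n 0).image (List.cons (-((h : ℤ) + 2)))

theorem mem_dyckSuffixes (n h : ℕ) (l : List ℤ) :
    l ∈ dyckSuffixes n h ↔ l.length = n ∧ CatValidFrom dyckJ h l ∧ h + l.sum = 0 := by
  induction n generalizing h l with
  | zero =>
    rcases h with _ | h
    · simp only [dyckSuffixes, Finset.mem_singleton, List.length_eq_zero_iff]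
      constructor
      · rintro rfl
        simp [CatValidFrom]
      · exact fun h => h.1
    · simp only [dyckSuffixes, Finset.notMem_empty, List.length_eq_zero_iff, false_iff]
      rintro ⟨rfl, -, h2⟩
      simp at h2
      omega
  | succ n ih =>
    rcases l with _ | ⟨s, r⟩
    · rcases h with _ | _ | h <;> simp [dyckSuffixes]
    · rcases h with _ | _ | h
      · simp only [dyckSuffixes, Finset.mem_image, List.cons.injEq, ih, CatValidFrom, dyckJ,
          List.length_cons, List.sum_cons]
        constructor
        · rintro ⟨a, ⟨h1, h2, h3⟩, rfl, rfl⟩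
          refine ⟨by omega, ⟨Or.inl ⟨by simp, by simp⟩, by simpa using h2⟩, ?_⟩
          push_cast at h3 ⊢
          omega
        · rintro ⟨h1, ⟨h2, h3⟩, h4⟩
          have hs : s = 1 := by
            rcases h2 with ⟨h5, h6⟩ | ⟨-, h5, -⟩
            · simp at h5 h6
              omega
            · simp at h5
          subst hs
          refine ⟨r, ⟨by omega, by simpa using h3, ?_⟩, rfl, rfl⟩
          push_cast at h4 ⊢
          omega
      · simp only [dyckSuffixes, Finset.mem_union, Finset.mem_image, List.cons.injEq, ih,
          CatValidFrom, dyckJ, List.length_cons, List.sum_cons]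
        constructor
        · rintro (⟨a, ⟨h1, h2, h3⟩, rfl, rfl⟩ | ⟨a, ⟨h1, h2, h3⟩, rfl, rfl⟩)
          · refine ⟨by omega, ⟨Or.inl ⟨by simp, by simp⟩, by simpa using h2⟩, ?_⟩
            push_cast at h3 ⊢
            omega
          · refine ⟨by omega, ⟨Or.inl ⟨by simp, by simp⟩, by simpa using h2⟩, ?_⟩
            push_cast at h3 ⊢
            omega
        · rintro ⟨h1, ⟨h2, h3⟩, h4⟩
          have hs : s = 1 ∨ s = -1 := by
            rcases h2 with ⟨h5, h6⟩ | ⟨h5, -, h6⟩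
            · simp at h5
              omega
            · simp at h6
          rcases hs with rfl | rfl
          · refine Or.inl ⟨r, ⟨by omega, by simpa using h3, ?_⟩, rfl, rfl⟩
            push_cast at h4 ⊢
            omega
          · refine Or.inr ⟨r, ⟨by omega, by simpa using h3, ?_⟩, rfl, rfl⟩
            push_cast at h4 ⊢
            omega
      · simp only [dyckSuffixes, Finset.mem_union, Finset.mem_image, List.cons.injEq, ih,
          CatValidFrom, dyckJ, List.length_cons, List.sum_cons]
        have e1 : ((h + 2 : ℕ) : ℤ) + 1 = (h + 3 : ℕ) := by push_cast; ring
        have e2 : ((h + 2 : ℕ) : ℤ) + -1 = (h + 1 : ℕ) := by push_cast; ring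
        have e3 : ((h + 2 : ℕ) : ℤ) + -((h : ℤ) + 2) = (0 : ℕ) := by push_cast; ring
        constructor
        · rintro ((⟨a, ⟨h1, h2, h3⟩, rfl, rfl⟩ | ⟨a, ⟨h1, h2, h3⟩, rfl, rfl⟩) |
            ⟨a, ⟨h1, h2, h3⟩, rfl, rfl⟩)
          · refine ⟨by omega, ⟨Or.inl ⟨by simp, by omega⟩, e1 ▸ h2⟩, ?_⟩
            push_cast at h3 ⊢
            omega
          · refine ⟨by omega, ⟨Or.inl ⟨by simp, by omega⟩, e2 ▸ h2⟩, ?_⟩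
            push_cast at h3 ⊢
            omega
          · refine ⟨by omega, ⟨Or.inr ⟨by push_cast; ring, by omega, ?_⟩, e3 ▸ h2⟩, ?_⟩
            · simp
              omega
            · push_cast at h3 ⊢
              omega
        · rintro ⟨h1, ⟨h2, h3⟩, h4⟩
          have hs : s = 1 ∨ s = -1 ∨ s = -((h : ℤ) + 2) := by
            rcases h2 with ⟨h5, h6⟩ | ⟨h5, -, h6⟩
            · simp at h5
              omega
            · push_cast at h5
              omega
          rcases hs with rfl | rfl | rfl
          · refine Or.inl (Or.inl ⟨r, ⟨by omega, e1 ▸ h3, ?_⟩, rfl, rfl⟩)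
            push_cast at h4 ⊢
            omega
          · refine Or.inl (Or.inr ⟨r, ⟨by omega, e2 ▸ h3, ?_⟩, rfl, rfl⟩)
            push_cast at h4 ⊢
            omega
          · refine Or.inr ⟨r, ⟨by omega, e3 ▸ h3, ?_⟩, rfl, rfl⟩
            push_cast at h4 ⊢
            omega

theorem dyckCat_iff (n : ℕ) (l : List ℤ) : DyckCat n l ↔ l ∈ dyckSuffixes n 0 := by
  simp [mem_dyckSuffixes, DyckCat]

/-- The generating polynomial of the number of catastrophes over `dyckSuffixes n h`. -/
noncomputable def catPoly (u : ℂ) (n h : ℕ) : ℂ :=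
  ∑ l ∈ dyckSuffixes n h, u ^ catNum dyckJ h l

theorem sum_image_cons (s : Finset (List ℤ)) (a : ℤ) (f : List ℤ → ℂ) :
    ∑ l ∈ s.image (List.cons a), f l = ∑ l ∈ s, f (a :: l) :=
  Finset.sum_image fun _ _ _ _ h => (List.cons.inj h).2

theorem disjoint_image_cons (s t : Finset (List ℤ)) {a b : ℤ} (hab : a ≠ b) :
    Disjoint (s.image (List.cons a)) (t.image (List.cons b)) := by
  rw [Finset.disjoint_left]
  intro l h1 h2
  obtain ⟨x, -, rfl⟩ := Finset.mem_image.1 h1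
  obtain ⟨y, -, h⟩ := Finset.mem_image.1 h2
  exact hab (List.cons.inj h).1.symm

theorem catPoly_zero_zero (u : ℂ) : catPoly u 0 0 = 1 := by
  simp [catPoly, dyckSuffixes, catNum]

theorem catPoly_zero_succ (u : ℂ) (h : ℕ) : catPoly u 0 (h + 1) = 0 := by
  simp [catPoly, dyckSuffixes]

theorem catPoly_succ_zero (u : ℂ) (n : ℕ) : catPoly u (n + 1) 0 = catPoly u n 1 := by
  simp [catPoly, dyckSuffixes, catNum]

theorem catPoly_succ_one (u : ℂ) (n : ℕ) :
    catPoly u (n + 1) 1 = catPoly u n 2 + catPoly u n 0 := by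
  simp only [catPoly, dyckSuffixes]
  rw [Finset.sum_union (disjoint_image_cons _ _ (by norm_num)), sum_image_cons, sum_image_cons]
  simp [catNum, dyckJ]

theorem catPoly_succ_add_two (u : ℂ) (n h : ℕ) :
    catPoly u (n + 1) (h + 2) = catPoly u n (h + 3) + catPoly u n (h + 1) + u * catPoly u n 0 := by
  have e1 : ((h + 2 : ℕ) : ℤ) + 1 = (h + 3 : ℕ) := by push_cast; ring
  have e2 : ((h + 2 : ℕ) : ℤ) + -1 = (h + 1 : ℕ) := by push_cast; ring
  have e3 : ((h + 2 : ℕ) : ℤ) + -((h : ℤ) + 2) = (0 : ℕ) := by push_cast; ring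
  simp only [catPoly, dyckSuffixes]
  rw [Finset.sum_union, Finset.sum_union (disjoint_image_cons _ _ (by norm_num)),
    sum_image_cons, sum_image_cons, sum_image_cons]
  · simp only [catNum, e1, e2, e3, Finset.mul_sum]
    refine congrArg₂ _ (congrArg₂ _ ?_ ?_) ?_ <;> refine Finset.sum_congr rfl fun l _ => ?_
    · rw [if_neg (by omega), zero_add]
    · rw [if_neg (by omega), zero_add]
    · rw [if_pos, pow_add, pow_one]
      refine ⟨by push_cast; ring, by omega, ?_⟩
      simp [dyckJ]
      omega
  · exact Finset.disjoint_union_left.2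
      ⟨disjoint_image_cons _ _ (by omega), disjoint_image_cons _ _ (by omega)⟩

/-- The transfer operator of the simple walk on `ℤ`. -/
def walkOp : Module.End ℂ (ℤ → ℂ) where
  toFun g m := g (m + 1) + g (m - 1)
  map_add' f g := by
    ext m
    simp only [Pi.add_apply]
    ring
  map_smul' c g := by
    ext m
    simp only [Pi.smul_apply, smul_eq_mul, RingHom.id_apply]
    ring

theorem walkOp_apply (g : ℤ → ℂ) (m : ℤ) : walkOp g m = g (m + 1) + g (m - 1) := rfl

theorem walkOp_pow_succ_apply (n : ℕ) (g : ℤ → ℂ) :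
    (walkOp ^ (n + 1)) g = (walkOp ^ n) (walkOp g) := by
  rw [pow_succ, Module.End.mul_apply]

theorem walkOp_pow_apply_zero_of_odd (n : ℕ) (g : ℤ → ℂ) (hg : ∀ m, g (-m) = -g m) :
    (walkOp ^ n) g 0 = 0 := by
  induction n generalizing g with
  | zero =>
    have := hg 0
    simp only [neg_zero] at this
    simpa using self_eq_neg.1 this
  | succ n ih =>
    rw [walkOp_pow_succ_apply]
    refine ih _ fun m => ?_
    rw [walkOp_apply, walkOp_apply, show -m + 1 = -(m - 1) by ring,
      show -m - 1 = -(m + 1) by ring, hg, hg]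
    ring

theorem norm_walkOp_pow_apply_le (n : ℕ) (g : ℤ → ℂ) (C : ℝ) (hg : ∀ m, ‖g m‖ ≤ C) (m : ℤ) :
    ‖(walkOp ^ n) g m‖ ≤ C * 2 ^ n := by
  induction n generalizing g C with
  | zero => simpa using hg m
  | succ n ih =>
    rw [walkOp_pow_succ_apply]
    refine (ih _ (C * 2) fun k => ?_).trans_eq (by ring)
    rw [walkOp_apply]
    exact (norm_add_le _ _).trans (by linarith [hg (k + 1), hg (k - 1)])

theorem walkOp_pow_zpow (n : ℕ) (A w : ℂ) (hw : w ≠ 0) :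
    (walkOp ^ n) (fun m => A * w ^ (-m)) 0 = A * (w + w⁻¹) ^ n := by
  induction n generalizing A with
  | zero => simp
  | succ n ih =>
    rw [walkOp_pow_succ_apply]
    have : walkOp (fun m => A * w ^ (-m)) = fun m => (A * (w + w⁻¹)) * w ^ (-m) := by
      ext m
      rw [walkOp_apply, show -(m + 1) = -m - 1 by ring, show -(m - 1) = -m + 1 by ring,
        zpow_add_one₀ hw, zpow_sub_one₀ hw]
      ring
    rw [this, ih]
    ring

/-- The coefficients of `(1 - X ^ 2) / (1 - X - u * X ^ 3)`. -/
def catCoeffNat (u : ℂ) : ℕ → ℂ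
  | 0 => 1
  | 1 => 1
  | 2 => 0
  | m + 3 => catCoeffNat u (m + 2) + u * catCoeffNat u m

/-- The coefficients of `(1 - X ^ 2) / (1 - X - u * X ^ 3)`, extended by `0` to negative
indices. -/
def catCoeff (u : ℂ) : ℤ → ℂ
  | Int.ofNat m => catCoeffNat u m
  | Int.negSucc _ => 0

theorem catCoeff_natCast (u : ℂ) (m : ℕ) : catCoeff u m = catCoeffNat u m := rfl

theorem catCoeff_of_neg (u : ℂ) {m : ℤ} (hm : m < 0) : catCoeff u m = 0 := by
  obtain ⟨k, rfl⟩ := Int.eq_negSucc_of_lt_zero hm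
  rfl

/-- In the variable `w` with `z = w / (1 + w ^ 2)`, the generating function (up to the Jacobian
factor) of the Dyck suffixes with catastrophes that start at altitude `h`. -/
def catSeq (u : ℂ) : ℕ → ℤ → ℂ
  | 0, m => catCoeff u m - catCoeff u (m - 1)
  | h + 1, m => u * ∑ i ∈ Finset.range (h + 1), catCoeff u (m - (i + 1 : ℕ)) +
      (1 - u) * (catCoeff u (m - (h + 1)) - catCoeff u (m - (h + 2)))

theorem catSeq_zero (u : ℂ) (m : ℤ) : catSeq u 0 m = catCoeff u m - catCoeff u (m - 1) := rfl

theorem catSeq_one (u : ℂ) (m : ℤ) :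
    catSeq u 1 m = catCoeff u (m - 1) - (1 - u) * catCoeff u (m - 2) := by
  simp [catSeq]
  ring

theorem walkOp_catSeq_one (u : ℂ) : walkOp (catSeq u 1) = catSeq u 2 + catSeq u 0 := by
  ext m
  simp only [walkOp_apply, Pi.add_apply, catSeq_one, catSeq_zero]
  simp only [catSeq, Finset.sum_range_succ, Finset.sum_range_zero]
  push_cast
  rw [show m + 1 - 1 = m by ring, show m + 1 - 2 = m - 1 by ring, show m - 1 - 1 = m - 2 by ring,
    show m - 1 - 2 = m - 3 by ring]
  ring

theorem sum_shift_identity (b : ℕ → ℂ) (N : ℕ) :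
    ∑ i ∈ Finset.range (N + 1), b i + ∑ i ∈ Finset.range (N + 1), b (i + 2) =
      ∑ i ∈ Finset.range (N + 2), b (i + 1) + ∑ i ∈ Finset.range N, b (i + 1) + (b 0 - b 1) := by
  induction N with
  | zero =>
    simp [Finset.sum_range_succ]
    ring
  | succ N ih =>
    rw [Finset.sum_range_succ b (N + 1), Finset.sum_range_succ (fun i => b (i + 2)) (N + 1),
      Finset.sum_range_succ (fun i => b (i + 1)) (N + 2),
      Finset.sum_range_succ (fun i => b (i + 1)) N]
    linear_combination ih

theorem walkOp_catSeq_add_two (u : ℂ) (h : ℕ) :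
    walkOp (catSeq u (h + 2)) = catSeq u (h + 3) + catSeq u (h + 1) + u • catSeq u 0 := by
  ext m
  have key := sum_shift_identity (fun i => catCoeff u (m - i)) (h + 1)
  simp only [walkOp_apply, Pi.add_apply, Pi.smul_apply, smul_eq_mul, catSeq_zero]
  simp only [catSeq]
  have e1 : ∀ i : ℕ, m + 1 - ((i + 1 : ℕ) : ℤ) = m - i := fun i => by push_cast; ring
  have e2 : ∀ i : ℕ, m - 1 - ((i + 1 : ℕ) : ℤ) = m - (i + 2 : ℕ) := fun i => by push_cast; ring
  simp only [e1, e2]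
  push_cast at key ⊢
  simp only [sub_zero] at key
  rw [show m + 1 - ((h : ℤ) + 1 + 1) = m - (h + 1) by ring,
    show m + 1 - ((h : ℤ) + 1 + 2) = m - (h + 2) by ring,
    show m - 1 - ((h : ℤ) + 1 + 1) = m - (h + 3) by ring,
    show m - 1 - ((h : ℤ) + 1 + 2) = m - (h + 4) by ring,
    show m - ((h : ℤ) + 2 + 1) = m - (h + 3) by ring,
    show m - ((h : ℤ) + 2 + 2) = m - (h + 4) by ring]
  linear_combination u * key

theorem walkOp_catSeq_zero (u : ℂ) : walkOp (catSeq u 0) =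
    catSeq u 1 + fun m : ℤ => (if m = -1 then 1 else 0) - if m = 1 then 1 else 0 := by
  ext m
  simp only [walkOp_apply, Pi.add_apply, catSeq_one, catSeq_zero]
  rw [show m + 1 - 1 = m by ring, show m - 1 - 1 = m - 2 by ring]
  rcases lt_or_ge m (-1) with hm | hm
  · rw [catCoeff_of_neg u (show m + 1 < 0 by omega), catCoeff_of_neg u (show m < 0 by omega),
      catCoeff_of_neg u (show m - 1 < 0 by omega), catCoeff_of_neg u (show m - 2 < 0 by omega),
      if_neg (by omega), if_neg (by omega)]
    ring
  · obtain ⟨k, rfl⟩ : ∃ k : ℕ, m = k - 1 := ⟨(m + 1).toNat, by omega⟩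
    rcases k with _ | _ | _ | k
    · have := catCoeff_natCast u 0
      simp [catCoeff_of_neg, catCoeffNat] at this ⊢
      exact this
    · have h0 := catCoeff_natCast u 0
      have h1 := catCoeff_natCast u 1
      simp [catCoeff_of_neg, catCoeffNat] at h0 h1 ⊢
      simp [h0, h1]
    · have h0 := catCoeff_natCast u 0
      have h1 := catCoeff_natCast u 1
      have h2 := catCoeff_natCast u 2
      simp [catCoeff_of_neg, catCoeffNat] at h0 h1 h2 ⊢
      simp [h0, h1, h2]
    · rw [if_neg (by push_cast; omega), if_neg (by push_cast; omega)]
      push_cast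
      have h0 := catCoeff_natCast u k
      have h2 := catCoeff_natCast u (k + 2)
      have h3 := catCoeff_natCast u (k + 3)
      rw [catCoeffNat] at h3
      push_cast at h0 h2 h3
      rw [show (k : ℤ) + 1 + 1 + 1 - 1 + 1 = k + 3 by ring,
        show (k : ℤ) + 1 + 1 + 1 - 1 - 2 = k by ring,
        show (k : ℤ) + 1 + 1 + 1 - 1 = k + 2 by ring, h0, h2, h3]
      ring

theorem catPoly_eq_walkOp_pow (u : ℂ) (n h : ℕ) : catPoly u n h = (walkOp ^ n) (catSeq u h) 0 := by
  induction n generalizing h with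
  | zero =>
    rcases h with _ | h
    · rw [catPoly_zero_zero]
      have h0 := catCoeff_natCast u 0
      simp [catSeq, catCoeff_of_neg, catCoeffNat] at h0 ⊢
      exact h0.symm
    · rw [catPoly_zero_succ]
      simp only [pow_zero, Module.End.one_apply, catSeq]
      rw [Finset.sum_eq_zero fun i _ => catCoeff_of_neg u (by push_cast; omega),
        catCoeff_of_neg u (by omega), catCoeff_of_neg u (by omega)]
      ring
  | succ n ih =>
    rw [walkOp_pow_succ_apply]
    rcases h with _ | _ | h
    · rw [catPoly_succ_zero, ih, walkOp_catSeq_zero, map_add, Pi.add_apply,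
        walkOp_pow_apply_zero_of_odd n (fun m : ℤ => (if m = -1 then 1 else 0) - _), add_zero]
      intro m
      have e1 : -m = -1 ↔ m = 1 := by omega
      have e2 : -m = 1 ↔ m = -1 := by omega
      simp only [e1, e2]
      ring
    · rw [catPoly_succ_one, ih, ih, walkOp_catSeq_one, map_add, Pi.add_apply]
    · rw [catPoly_succ_add_two, ih, ih, ih, walkOp_catSeq_add_two, map_add, map_add, map_smul]
      rfl

theorem norm_le_of_two_step_recurrence {x : ℕ → ℂ} {a b : ℂ} {C : ℝ}
    (hx : ∀ m, x (m + 2) = -a * x (m + 1) - b * x m) (hab : ‖a ^ 2 - b‖ + ‖a * b‖ ≤ 1)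
    (h0 : ‖x 0‖ ≤ C) (h1 : ‖x 1‖ ≤ C) (h2 : ‖x 2‖ ≤ C) (m : ℕ) : ‖x m‖ ≤ C := by
  suffices ‖x m‖ ≤ C ∧ ‖x (m + 1)‖ ≤ C ∧ ‖x (m + 2)‖ ≤ C from this.1
  induction m with
  | zero => exact ⟨h0, h1, h2⟩
  | succ m ih =>
    obtain ⟨i0, i1, i2⟩ := ih
    refine ⟨i1, i2, ?_⟩
    have : x (m + 1 + 2) = (a ^ 2 - b) * x (m + 1) + (a * b) * x m := by
      rw [hx (m + 1), hx m]
      ring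
    rw [this]
    refine (norm_add_le _ _).trans ?_
    rw [norm_mul, norm_mul]
    have hC : 0 ≤ C := (norm_nonneg _).trans h0
    nlinarith [mul_le_mul_of_nonneg_left i1 (norm_nonneg (a ^ 2 - b)),
      mul_le_mul_of_nonneg_left i0 (norm_nonneg (a * b))]

theorem norm_catPoly_sub_le {u w : ℂ} (huw : u * w ^ 3 = 1 - w) (hw1 : ‖w‖ ≤ 1)
    (hw2 : 1 / 2 ≤ ‖w‖) (hw3 : 1 ≤ ‖3 - 2 * w‖)
    (hw4 : ‖((1 - w) / w) ^ 2 - (1 - w) / w ^ 2‖ + ‖(1 - w) / w * ((1 - w) / w ^ 2)‖ ≤ 1)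
    (n : ℕ) :
    ‖catPoly u n 0 - (1 - w) * (1 - w ^ 2) / (3 - 2 * w) * (w + w⁻¹) ^ n‖ ≤ 48 * 2 ^ n := by
  have hw0 : w ≠ 0 := by
    rintro rfl
    norm_num at hw2
  have hw3' : 3 - 2 * w ≠ 0 := by
    intro h
    rw [h] at hw3
    norm_num at hw3
  set A := (1 - w) * (1 - w ^ 2) / (3 - 2 * w) with hA
  have hA' : A * (3 - 2 * w) = (1 - w) * (1 - w ^ 2) := div_mul_cancel₀ _ hw3'
  have n1 : ‖1 - w‖ ≤ 2 := (norm_sub_le _ _).trans (by rw [norm_one]; linarith)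
  have n2 : ‖1 - w ^ 2‖ ≤ 2 := by
    refine (norm_sub_le _ _).trans ?_
    rw [norm_one, norm_pow]
    nlinarith [norm_nonneg w]
  have nA : ‖A‖ ≤ 4 := by
    rw [hA, norm_div, norm_mul]
    refine (div_le_self (by positivity) hw3).trans ?_
    nlinarith [norm_nonneg (1 - w), norm_nonneg (1 - w ^ 2)]
  have ninv : ‖w⁻¹‖ ≤ 2 := by
    rw [norm_inv]
    exact inv_le_of_inv_le₀ (by norm_num) (by linarith)
  have hu : u = (1 - w) * w⁻¹ ^ 3 := by
    rw [← huw]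
    field_simp
  have nu : ‖u‖ ≤ 16 := by
    rw [hu, norm_mul, norm_pow]
    calc _ ≤ (2 : ℝ) * 2 ^ 3 := by gcongr
      _ = 16 := by norm_num
  set d : ℤ → ℂ := fun m => catSeq u 0 m - A * w ^ (-m) with hd
  have hzpow : ∀ m : ℕ, w ^ (-(m : ℤ)) = w⁻¹ ^ m := fun m => by
    rw [zpow_neg, zpow_natCast, inv_pow]
  have seq : ∀ m : ℕ, catSeq u 0 (m + 1 : ℕ) = catCoeffNat u (m + 1) - catCoeffNat u m := by
    intro m
    rw [catSeq_zero, ← catCoeff_natCast, ← catCoeff_natCast]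
    push_cast
    rw [add_sub_cancel_right]
  have s1 : catSeq u 0 (1 : ℕ) = 0 := by rw [seq 0]; simp [catCoeffNat]
  have s2 : catSeq u 0 (2 : ℕ) = -1 := by rw [seq 1]; simp [catCoeffNat]
  have s3 : catSeq u 0 (3 : ℕ) = u := by rw [seq 2]; simp [catCoeffNat]
  have rec4 : ∀ m : ℕ, catSeq u 0 (m + 4 : ℕ) =
      catSeq u 0 (m + 3 : ℕ) + u * catSeq u 0 (m + 1 : ℕ) := by
    intro m
    rw [seq (m + 3), seq (m + 2), seq m]
    simp only [catCoeffNat]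
    ring
  have hy : ∀ m : ℕ, catSeq u 0 (m + 3 : ℕ) + (1 - w) / w * catSeq u 0 (m + 2 : ℕ) +
      (1 - w) / w ^ 2 * catSeq u 0 (m + 1 : ℕ) = (1 - w) * (1 - w ^ 2) * w⁻¹ ^ (m + 3) := by
    intro m
    induction m with
    | zero =>
      rw [s1, s2, s3, hu]
      simp only [inv_pow]
      field_simp
      ring
    | succ m ih =>
      rw [pow_succ _ (m + 3), ← mul_assoc, ← ih, show m + 1 + 3 = m + 4 by ring,
        show m + 1 + 2 = m + 3 by ring, show m + 1 + 1 = m + 2 by ring, rec4, hu]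
      field_simp
      ring
  have hdrec : ∀ m : ℕ, d (m + 2 + 1 : ℕ) = -((1 - w) / w) * d (m + 1 + 1 : ℕ) -
      (1 - w) / w ^ 2 * d (m + 1 : ℕ) := by
    intro m
    simp only [hd, hzpow]
    have h1 := hy m
    rw [← hA'] at h1
    rw [show m + 2 + 1 = m + 3 by ring, show m + 1 + 1 = m + 2 by ring]
    have e : A * (3 - 2 * w) * w⁻¹ ^ (m + 3) = A * w⁻¹ ^ (m + 3) +
        (1 - w) / w * (A * w⁻¹ ^ (m + 2)) + (1 - w) / w ^ 2 * (A * w⁻¹ ^ (m + 1)) := by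
      simp only [pow_succ]
      field_simp
      ring
    rw [e] at h1
    linear_combination h1
  have hAw : ∀ m : ℕ, m ≤ 3 → ‖A * w ^ (-(m : ℤ))‖ ≤ 32 := by
    intro m hm
    rw [hzpow, norm_mul, norm_pow]
    calc _ ≤ (4 : ℝ) * 2 ^ m := by gcongr
      _ ≤ 4 * 2 ^ 3 := by gcongr; norm_num
      _ = 32 := by norm_num
  have d1 : ‖d (1 : ℕ)‖ ≤ 48 :=
    (norm_sub_le _ _).trans (by rw [s1, norm_zero]; linarith [hAw 1 (by norm_num)])
  have d2 : ‖d (2 : ℕ)‖ ≤ 48 :=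
    (norm_sub_le _ _).trans (by rw [s2, norm_neg, norm_one]; linarith [hAw 2 (by norm_num)])
  have d3 : ‖d (3 : ℕ)‖ ≤ 48 :=
    (norm_sub_le _ _).trans (by rw [s3]; linarith [hAw 3 le_rfl])
  have hdpos : ∀ m : ℕ, ‖d (m + 1 : ℕ)‖ ≤ 48 :=
    norm_le_of_two_step_recurrence (x := fun m : ℕ => d (m + 1 : ℕ)) hdrec hw4 d1 d2 d3
  have hdall : ∀ m : ℤ, ‖d m‖ ≤ 48 := by
    intro m
    rcases lt_trichotomy m 0 with hm | rfl | hm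
    · simp only [hd, catSeq_zero]
      obtain ⟨k, rfl⟩ : ∃ k : ℕ, m = -k := ⟨m.natAbs, by omega⟩
      rw [catCoeff_of_neg u hm, catCoeff_of_neg u (by omega), neg_neg, zpow_natCast, sub_self,
        zero_sub, norm_neg, norm_mul, norm_pow]
      have := pow_le_one₀ (norm_nonneg w) hw1 (n := k)
      nlinarith [norm_nonneg A]
    · have h0 := catCoeff_natCast u 0
      simp [catCoeffNat] at h0
      simp only [hd, catSeq_zero, h0, catCoeff_of_neg u (show (0 : ℤ) - 1 < 0 by norm_num)]
      refine (norm_sub_le _ _).trans ?_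
      simp
      linarith
    · obtain ⟨k, rfl⟩ : ∃ k : ℕ, m = (k + 1 : ℕ) := ⟨m.toNat - 1, by omega⟩
      exact hdpos k
  have := norm_walkOp_pow_apply_le n d 48 hdall 0
  rwa [show d = catSeq u 0 - (fun m : ℤ => A * w ^ (-m)) from rfl, map_sub, Pi.sub_apply,
    walkOp_pow_zpow n A w hw0, ← catPoly_eq_walkOp_pow] at this

theorem exists_root_cubic : ∃ c : ℝ, 0.68 < c ∧ c < 0.69 ∧ c ^ 3 = 1 - c := by
  have hcont : ContinuousOn (fun c : ℝ => c ^ 3 + c - 1) (Set.Icc 0.68 0.69) := by fun_prop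
  obtain ⟨c, hc, h⟩ := intermediate_value_Ioo (by norm_num) hcont
    (show (0 : ℝ) ∈ Set.Ioo _ _ by norm_num)
  exact ⟨c, hc.1, hc.2, by simp only at h; linarith⟩

theorem mean_eq_of_root {c μ : ℝ} (hc : c ^ 3 = 1 - c)
    (hμ : 31 * μ ^ 3 + 31 * μ ^ 2 + 40 * μ - 3 = 0) :
    μ = (-13 + 25 * c - 4 * c ^ 2) / 31 := by
  set m := (-13 + 25 * c - 4 * c ^ 2) / 31 with hm
  have h : 31 * m ^ 3 + 31 * m ^ 2 + 40 * m - 3 = 0 := by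
    rw [hm]
    linear_combination (15961 / 961 - 244 / 31 * c + 1200 / 961 * c ^ 2 - 64 / 961 * c ^ 3) * hc
  have h2 : (μ - m) * (31 * (μ ^ 2 + μ * m + m ^ 2) + 31 * (μ + m) + 40) = 0 := by
    linear_combination hμ - h
  rcases mul_eq_zero.1 h2 with h3 | h3
  · linarith
  · nlinarith [sq_nonneg (μ + m + 2 / 3), sq_nonneg (μ - m)]

theorem variance_eq_of_root {c v : ℝ} (hc : c ^ 3 = 1 - c)
    (hv : 29791 * v ^ 3 - 59582 * v ^ 2 + 60579 * v - 2927 = 0) :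
    v = (160 + 329 * c - 721 * c ^ 2) / 961 := by
  set y := (160 + 329 * c - 721 * c ^ 2) / 961 with hy
  have h : 29791 * y ^ 3 - 59582 * y ^ 2 + 60579 * y - 2927 = 0 := by
    rw [hy]
    linear_combination (-168166383 / 29791 - 19642924 / 961 * c + 513083067 / 29791 * c ^ 2 -
      374805361 / 29791 * c ^ 3) * hc
  have h2 : (v - y) * (29791 * (v ^ 2 + v * y + y ^ 2) - 59582 * (v + y) + 60579) = 0 := by
    linear_combination hv - h
  rcases mul_eq_zero.1 h2 with h3 | h3
  · linarith
  · nlinarith [sq_nonneg (v + y - 4 / 3), sq_nonneg (v - y)]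

/-- The branch of solutions `w` of `exp s * w ^ 3 = 1 - w` through a given solution at `s = 0`. -/
theorem exists_saddle_branch {c : ℂ} (hc : c ^ 3 = 1 - c) (hc0 : c ≠ 0) (hc3 : 3 - 2 * c ≠ 0) :
    ∃ W : ℂ → ℂ, W 0 = c ∧ ∀ᶠ s in 𝓝 0, Complex.exp s * W s ^ 3 = 1 - W s ∧
      HasDerivAt W (-(W s * (1 - W s) / (3 - 2 * W s))) s := by
  set U : ℂ → ℂ := fun w => (1 - w) / w ^ 3 with hU
  have hUd : ∀ w : ℂ, w ≠ 0 → HasDerivAt U (-(3 - 2 * w) / w ^ 4) w := by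
    intro w hw
    have h1 := ((hasDerivAt_id w).const_sub 1).div (hasDerivAt_pow 3 w) (pow_ne_zero 3 hw)
    refine h1.congr_deriv ?_
    simp only [id]
    field_simp
    push_cast
    ring
  have hUa : AnalyticAt ℂ U c := by
    refine AnalyticAt.div (by fun_prop) (by fun_prop) (pow_ne_zero 3 hc0)
  have hU' : deriv U c ≠ 0 := by
    rw [(hUd c hc0).deriv]
    exact div_ne_zero (neg_ne_zero.2 hc3) (pow_ne_zero 4 hc0)
  have hUc : U c = 1 := by
    simp only [hU]
    rw [hc, div_self]
    rw [← hc]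
    exact pow_ne_zero 3 hc0
  set g := hUa.hasStrictDerivAt.localInverse _ _ _ hU' with hg
  have hga : AnalyticAt ℂ g 1 := hUc ▸ hUa.analyticAt_localInverse hU'
  have hgr : ∀ᶠ x in 𝓝 (1 : ℂ), U (g x) = x :=
    hUc ▸ hUa.hasStrictDerivAt.eventually_right_inverse hU'
  have hg1 : g 1 = c := hUc ▸ HasStrictFDerivAt.localInverse_apply_image ..
  have hgc := hga.continuousAt
  have hg0 : ∀ᶠ x in 𝓝 (1 : ℂ), g x ≠ 0 := hgc.eventually_ne (hg1 ▸ hc0)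
  have hg3 : ∀ᶠ x in 𝓝 (1 : ℂ), 3 - 2 * g x ≠ 0 := by
    have : ContinuousAt (fun x => 3 - 2 * g x) 1 := by fun_prop
    exact this.eventually_ne (by simpa [hg1] using hc3)
  have hexp : Tendsto Complex.exp (𝓝 0) (𝓝 1) := by
    simpa using Complex.continuous_exp.tendsto 0
  refine ⟨fun s => g (Complex.exp s), by simpa using hg1, ?_⟩
  have hall := hgr.eventually_nhds.and (hg0.and (hg3.and hga.eventually_analyticAt))
  filter_upwards [hexp.eventually hall] with s ⟨h1, h2, h3, h4⟩
  have e1 : U (g (Complex.exp s)) = Complex.exp s := h1.self_of_nhds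
  have e2 : Complex.exp s * g (Complex.exp s) ^ 3 = 1 - g (Complex.exp s) :=
    ((div_eq_iff (pow_ne_zero 3 h2)).1 e1).symm
  refine ⟨e2, ?_⟩
  have hgd := h4.differentiableAt.hasDerivAt
  have hid : HasDerivAt (fun x => U (g x)) 1 (Complex.exp s) :=
    (hasDerivAt_id (Complex.exp s)).congr_of_eventuallyEq h1
  have hcomp := ((hUd _ h2).comp _ hgd).unique hid
  have hd := hgd.comp s (Complex.hasDerivAt_exp s)
  refine hd.congr_deriv ?_
  set x := g (Complex.exp s)
  set D := deriv g (Complex.exp s)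
  have hD : D = -x ^ 4 / (3 - 2 * x) := by
    field_simp at hcomp ⊢
    linear_combination -hcomp
  rw [hD, ← e2]
  ring

theorem isLittleO_taylor_two {f F : ℂ → ℂ} {v : ℂ} (hf : ∀ᶠ s in 𝓝 0, HasDerivAt f (F s) s)
    (hF : HasDerivAt F v 0) (hF0 : F 0 = 0) :
    (fun s => f s - f 0 - v / 2 * s ^ 2) =o[𝓝 0] fun s => s ^ 2 := by
  rw [Asymptotics.isLittleO_iff]
  intro ε hε
  have h1 := hF.isLittleO
  rw [Asymptotics.isLittleO_iff] at h1
  obtain ⟨δ, hδ, hball⟩ := Metric.eventually_nhds_iff_ball.1 (hf.and (h1 hε))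
  filter_upwards [Metric.ball_mem_nhds 0 hδ] with s hs
  have hsub : ∀ x ∈ Metric.closedBall (0 : ℂ) ‖s‖, x ∈ Metric.ball (0 : ℂ) δ := by
    intro x hx
    rw [mem_closedBall_zero_iff] at hx
    rw [mem_ball_zero_iff] at hs ⊢
    exact hx.trans_lt hs
  have key := Convex.norm_image_sub_le_of_norm_hasDerivWithin_le
    (f := fun s => f s - f 0 - v / 2 * s ^ 2) (f' := fun s => F s - v * s)
    (s := Metric.closedBall (0 : ℂ) ‖s‖) (x := 0) (y := s) (C := ε * ‖s‖)
    (fun x hx => by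
      have := ((hball x (hsub x hx)).1.sub_const (f 0)).sub ((hasDerivAt_pow 2 x).const_mul (v / 2))
      refine (this.congr_deriv ?_).hasDerivWithinAt
      push_cast
      ring)
    (fun x hx => by
      have := (hball x (hsub x hx)).2
      simp only [hF0, sub_zero, smul_eq_mul] at this
      rw [mem_closedBall_zero_iff] at hx
      rw [mul_comm v]
      exact this.trans (by gcongr))
    (convex_closedBall 0 _) (by simp) (by simp)
  simp only [sub_self, ne_eq, OfNat.ofNat_ne_zero, not_false_eq_true, zero_pow, mul_zero,
    sub_zero] at key
  rw [norm_pow]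
  exact key.trans_eq (by ring)

theorem tendsto_pow_of_taylor_two {f : ℂ → ℂ} {v : ℂ} (hf0 : f 0 = 1)
    (hf : (fun s => f s - f 0 - v / 2 * s ^ 2) =o[𝓝 0] fun s => s ^ 2) (z : ℂ) :
    Tendsto (fun n : ℕ => f (z / (√(n : ℝ) : ℝ)) ^ n) atTop (𝓝 (Complex.exp (v * z ^ 2 / 2))) := by
  have hsq : Tendsto (fun n : ℕ => z / ((√(n : ℝ) : ℝ) : ℂ)) atTop (𝓝 0) := by
    rw [tendsto_zero_iff_norm_tendsto_zero]
    have h1 : Tendsto (fun n : ℕ => √(n : ℝ)) atTop atTop :=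
      Real.tendsto_sqrt_atTop.comp tendsto_natCast_atTop_atTop
    refine (h1.const_div_atTop ‖z‖).congr fun n => ?_
    rw [norm_div, Complex.norm_real, Real.norm_of_nonneg (Real.sqrt_nonneg _)]
  have hn : ∀ n : ℕ, 0 < n → (n : ℂ) * (z / ((√(n : ℝ) : ℝ) : ℂ)) ^ 2 = z ^ 2 := by
    intro n hn
    have h0 : ((√(n : ℝ) : ℝ) : ℂ) ^ 2 = n := by
      rw [← Complex.ofReal_pow, Real.sq_sqrt (Nat.cast_nonneg n), Complex.ofReal_natCast]
    have h1 : (n : ℂ) ≠ 0 := by exact_mod_cast hn.ne'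
    rw [div_pow, h0]
    field_simp
  have hlo := hf.comp_tendsto hsq
  have hlo2 : (fun n : ℕ => (n : ℂ) * (f (z / (√(n : ℝ) : ℝ)) - f 0 -
      v / 2 * (z / (√(n : ℝ) : ℝ)) ^ 2)) =o[atTop] fun _ => (z ^ 2 : ℂ) := by
    refine ((Asymptotics.isBigO_refl (fun n : ℕ => (n : ℂ)) atTop).mul_isLittleO hlo).congr'
      (Eventually.of_forall fun n => rfl) ?_
    filter_upwards [eventually_gt_atTop 0] with n h using hn n h
  have hlim : Tendsto (fun n : ℕ => (n : ℂ) * (f (z / (√(n : ℝ) : ℝ)) - 1)) atTop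
      (𝓝 (v * z ^ 2 / 2)) := by
    have h0 := (Asymptotics.isLittleO_one_iff ℂ).1 (hlo2.trans_isBigO
      (Asymptotics.isBigO_const_const (z ^ 2) (one_ne_zero (α := ℂ)) atTop))
    refine ((h0.add_const (v * z ^ 2 / 2)).congr' ?_).trans_eq (by rw [zero_add])
    filter_upwards [eventually_gt_atTop 0] with n h
    rw [hf0]
    linear_combination (-v / 2) * hn n h
  exact (Complex.tendsto_one_add_pow_exp_of_tendsto hlim).congr fun n => by
    rw [add_sub_cancel]

theorem eventually_norm_catPoly_sub_le {c : ℝ} (h1 : 0.68 < c) (h2 : c < 0.69)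
    (hc : c ^ 3 = 1 - c) :
    ∀ᶠ w in 𝓝 (c : ℂ), ∀ u : ℂ, u * w ^ 3 = 1 - w → ∀ n : ℕ,
      ‖catPoly u n 0 - (1 - w) * (1 - w ^ 2) / (3 - 2 * w) * (w + w⁻¹) ^ n‖ ≤ 48 * 2 ^ n := by
  have hc0 : (c : ℂ) ≠ 0 := by exact_mod_cast (show c ≠ 0 by linarith)
  have hcC : (c : ℂ) ^ 3 = 1 - c := by exact_mod_cast hc
  have hcn : ‖(c : ℂ)‖ = c := by rw [Complex.norm_real, Real.norm_of_nonneg (by linarith)]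
  have e1 : ∀ᶠ w in 𝓝 (c : ℂ), ‖w‖ < 1 :=
    continuous_norm.continuousAt.eventually_lt continuousAt_const (by rw [hcn]; linarith)
  have e2 : ∀ᶠ w in 𝓝 (c : ℂ), 1 / 2 < ‖w‖ :=
    continuousAt_const.eventually_lt continuous_norm.continuousAt (by rw [hcn]; linarith)
  have e3 : ∀ᶠ w in 𝓝 (c : ℂ), 1 < ‖3 - 2 * w‖ := by
    refine ContinuousAt.eventually_lt continuousAt_const (by fun_prop) ?_
    rw [show (3 : ℂ) - 2 * c = ((3 - 2 * c : ℝ) : ℂ) by push_cast; ring, Complex.norm_real,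
      Real.norm_of_nonneg (by linarith)]
    linarith
  have e4 : ∀ᶠ w in 𝓝 (c : ℂ), ‖((1 - w) / w) ^ 2 - (1 - w) / w ^ 2‖ +
      ‖(1 - w) / w * ((1 - w) / w ^ 2)‖ < 1 := by
    have hc2 : (c : ℂ) ^ 2 ≠ 0 := pow_ne_zero 2 hc0
    refine ContinuousAt.eventually_lt (by fun_prop (disch := assumption)) continuousAt_const ?_
    have a1 : (1 - (c : ℂ)) / c = c ^ 2 := by
      rw [← hcC]
      field_simp
    have a2 : (1 - (c : ℂ)) / c ^ 2 = c := by
      rw [← hcC]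
      field_simp
    rw [a1, a2, show ((c : ℂ) ^ 2) ^ 2 - c = ((-(c - c ^ 4) : ℝ) : ℂ) by push_cast; ring,
      show (c : ℂ) ^ 2 * c = ((c ^ 3 : ℝ) : ℂ) by push_cast; ring, Complex.norm_real,
      Complex.norm_real, norm_neg, Real.norm_of_nonneg, Real.norm_of_nonneg]
    · rw [show c - c ^ 4 = c - c * c ^ 3 by ring, hc]
      nlinarith
    · positivity
    · rw [show c - c ^ 4 = c - c * c ^ 3 by ring, hc]
      nlinarith
  filter_upwards [e1, e2, e3, e4] with w w1 w2 w3 w4 u hu n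
  exact norm_catPoly_sub_le hu w1.le w2.le w3.le w4.le n

theorem tendsto_normalized_catPoly {c : ℝ} (h1 : 0.68 < c) (h2 : c < 0.69)
    (hc : c ^ 3 = 1 - c) {m v : ℝ} (hm : m = (-13 + 25 * c - 4 * c ^ 2) / 31)
    (hv : v = (160 + 329 * c - 721 * c ^ 2) / 961) (τ : ℝ) :
    Tendsto (fun n : ℕ => catPoly (Complex.exp (τ * Complex.I / (√(n : ℝ) : ℝ))) n 0 *
        Complex.exp (-m * (τ * Complex.I / (√(n : ℝ) : ℝ))) ^ n / ((c + c⁻¹ : ℝ) : ℂ) ^ n) atTop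
      (𝓝 ((1 - c) * (1 - c ^ 2) / (3 - 2 * c) * Complex.exp (-(v * τ ^ 2 / 2)))) := by
  have hc0' : c ≠ 0 := by linarith
  have hc0 : (c : ℂ) ≠ 0 := by exact_mod_cast hc0'
  have hcC : (c : ℂ) ^ 3 = 1 - c := by exact_mod_cast hc
  have hc3 : (3 : ℂ) - 2 * c ≠ 0 := by exact_mod_cast (show (3 : ℝ) - 2 * c ≠ 0 by linarith)
  have hc2 : (1 : ℂ) + c ^ 2 ≠ 0 := by exact_mod_cast (show (1 : ℝ) + c ^ 2 ≠ 0 by positivity)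
  have hlam : 2 < c + c⁻¹ := by
    have : c + c⁻¹ - 2 = (1 - c) ^ 2 * c⁻¹ := by
      field_simp
      ring
    have h3 : 0 < (1 - c) ^ 2 * c⁻¹ :=
      mul_pos (pow_pos (by linarith) 2) (inv_pos.2 (by linarith))
    linarith
  have hlamC : (c : ℂ) + (c : ℂ)⁻¹ ≠ 0 := by
    exact_mod_cast (show c + c⁻¹ ≠ 0 by linarith)
  obtain ⟨W, hW0, hW⟩ := exists_saddle_branch hcC hc0 hc3
  have hWd : HasDerivAt W (-(c * (1 - c) / (3 - 2 * c))) 0 := by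
    simpa only [hW0] using hW.self_of_nhds.2
  have hWc := hWd.continuousAt
  have hWt : Tendsto W (𝓝 0) (𝓝 (c : ℂ)) := hW0 ▸ hWc.tendsto
  -- the mean drift as a function of the saddle point
  set N : ℂ → ℂ := fun w => (1 - w ^ 2) * (1 - w) with hN
  set D : ℂ → ℂ := fun w => (1 + w ^ 2) * (3 - 2 * w) with hD
  set f : ℂ → ℂ := fun s => (W s + (W s)⁻¹) / (c + (c : ℂ)⁻¹) * Complex.exp (-m * s) with hf
  set F : ℂ → ℂ := fun s => (N (W s) / D (W s) - m) * f s with hF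
  have hf0 : f 0 = 1 := by simp [hf, hW0, div_self hlamC]
  have hfd : ∀ᶠ s in 𝓝 0, HasDerivAt f (F s) s := by
    have g1 : ∀ᶠ s in 𝓝 0, W s ≠ 0 := hWt.eventually_ne hc0
    have g2 : ∀ᶠ s in 𝓝 0, 3 - 2 * W s ≠ 0 := by
      have : ContinuousAt (fun s => 3 - 2 * W s) 0 := by fun_prop
      exact this.eventually_ne (by simpa [hW0] using hc3)
    have g3 : ∀ᶠ s in 𝓝 0, 1 + W s ^ 2 ≠ 0 := by
      have : ContinuousAt (fun s => 1 + W s ^ 2) 0 := by fun_prop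
      exact this.eventually_ne (by simpa [hW0] using hc2)
    filter_upwards [hW, g1, g2, g3] with s ⟨_, d⟩ k1 k2 k3
    have dexp : HasDerivAt (fun s : ℂ => Complex.exp (-m * s)) (Complex.exp (-m * s) * (-m)) s := by
      simpa using ((hasDerivAt_id s).const_mul (-(m : ℂ))).cexp
    refine (((d.add (d.inv k1)).div_const (c + (c : ℂ)⁻¹)).mul dexp).congr_deriv ?_
    simp only [hF, hf, hN, hD, Pi.add_apply, Pi.inv_apply]
    field_simp
    ring
  have hNc : N c / D c = m := by
    rw [div_eq_iff (mul_ne_zero hc2 hc3), hm]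
    simp only [hN]
    push_cast
    linear_combination (-70 / 31 + 2 * (c : ℂ) - 8 / 31 * c ^ 2) * hcC
  have hF0 : F 0 = 0 := by simp [hF, hW0, hNc]
  have hFd : HasDerivAt F v 0 := by
    have dN : HasDerivAt N (-1 - 2 * c + 3 * c ^ 2) (c : ℂ) := by
      refine (((hasDerivAt_pow 2 (c : ℂ)).const_sub 1).mul
        ((hasDerivAt_id (c : ℂ)).const_sub 1)).congr_deriv ?_
      simp only [id]
      push_cast
      ring
    have dD : HasDerivAt D (-2 + 6 * c - 6 * c ^ 2) (c : ℂ) := by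
      refine (((hasDerivAt_pow 2 (c : ℂ)).const_add 1).mul
        (((hasDerivAt_id (c : ℂ)).const_mul 2).const_sub 3)).congr_deriv ?_
      simp only [id]
      push_cast
      ring
    have dq := ((dN.div dD (mul_ne_zero hc2 hc3)).sub_const (m : ℂ))
    rw [← hW0] at dq
    have dq2 := (dq.comp 0 hWd).mul hfd.self_of_nhds
    refine dq2.congr_deriv ?_
    simp only [Function.comp, hW0, hF0, hf0, Pi.div_apply, mul_zero, add_zero, mul_one]
    simp only [hN, hD]
    have hDne : ((1 + (c : ℂ) ^ 2) * (3 - 2 * c)) ^ 2 ≠ 0 := pow_ne_zero 2 (mul_ne_zero hc2 hc3)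
    rw [hv, mul_neg, ← neg_mul, neg_mul, ← mul_neg, ← neg_div, div_mul_div_comm,
      div_eq_iff (mul_ne_zero hDne hc3)]
    push_cast
    linear_combination (4320 / 961 + 3602 / 961 * (c : ℂ) - 29802 / 961 * c ^ 2 +
      55254 / 961 * c ^ 3 - 55266 / 961 * c ^ 4 + 28588 / 961 * c ^ 5 - 5768 / 961 * c ^ 6) * hcC
  have hpow := tendsto_pow_of_taylor_two hf0 (isLittleO_taylor_two hfd hFd hF0) (τ * Complex.I)
  rw [mul_pow, Complex.I_sq, show (v : ℂ) * (τ ^ 2 * -1) / 2 = -(v * τ ^ 2 / 2) by ring] at hpow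
  set s : ℕ → ℂ := fun n => τ * Complex.I / (√(n : ℝ) : ℝ) with hs
  have hs0 : Tendsto s atTop (𝓝 0) := by
    rw [tendsto_zero_iff_norm_tendsto_zero]
    have k1 : Tendsto (fun n : ℕ => √(n : ℝ)) atTop atTop :=
      Real.tendsto_sqrt_atTop.comp tendsto_natCast_atTop_atTop
    refine (k1.const_div_atTop ‖(τ : ℂ) * Complex.I‖).congr fun n => ?_
    rw [hs, norm_div, Complex.norm_real, Real.norm_of_nonneg (Real.sqrt_nonneg _)]
  set A : ℂ → ℂ := fun w => (1 - w) * (1 - w ^ 2) / (3 - 2 * w) with hA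
  have hAc : Tendsto (fun n => A (W (s n))) atTop (𝓝 (A c)) := by
    have : ContinuousAt A c := by fun_prop (disch := assumption)
    exact this.tendsto.comp (hWt.comp hs0)
  have hmain := hAc.mul hpow
  have hexp1 : ∀ n, ‖Complex.exp (-m * s n)‖ = 1 := by
    intro n
    rw [show -(m : ℂ) * s n = ((-m * τ / √(n : ℝ) : ℝ) : ℂ) * Complex.I by
      simp only [hs]
      push_cast
      ring]
    exact Complex.norm_exp_ofReal_mul_I _
  have herr : Tendsto (fun n : ℕ => (catPoly (Complex.exp (s n)) n 0 -
      A (W (s n)) * (W (s n) + (W (s n))⁻¹) ^ n) * Complex.exp (-m * s n) ^ n /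
        ((c + c⁻¹ : ℝ) : ℂ) ^ n) atTop (𝓝 0) := by
    have hgeo : Tendsto (fun n : ℕ => 48 * (2 / (c + c⁻¹)) ^ n) atTop (𝓝 0) := by
      simpa using (tendsto_pow_atTop_nhds_zero_of_lt_one (r := 2 / (c + c⁻¹)) (by positivity)
        ((div_lt_one (by linarith)).2 hlam)).const_mul 48
    refine squeeze_zero_norm' ?_ hgeo
    filter_upwards [hs0.eventually hW,
      (hWt.comp hs0).eventually (eventually_norm_catPoly_sub_le h1 h2 hc)] with n ⟨k1, _⟩ k2
    have k3 := k2 _ k1 n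
    rw [norm_div, norm_mul, norm_pow, hexp1, one_pow, mul_one, norm_pow, Complex.norm_real,
      Real.norm_of_nonneg (by linarith), div_pow, ← mul_div_assoc]
    gcongr
    exact k3
  refine ((herr.add hmain).congr fun n => ?_).trans_eq (by rw [zero_add])
  change _ + A (W (s n)) * f (s n) ^ n =
    catPoly (Complex.exp (s n)) n 0 * Complex.exp (-m * s n) ^ n / _
  simp only [hf]
  push_cast
  rw [mul_pow, div_pow]
  generalize (c : ℂ) + (c : ℂ)⁻¹ = L
  generalize W (s n) + (W (s n))⁻¹ = M
  ring

theorem gaussianCDF_eq (x : ℝ) :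
    gaussianCDF x = (ProbabilityTheory.gaussianReal 0 1).real (Set.Iic x) := by
  rw [MeasureTheory.measureReal_def,
    ProbabilityTheory.gaussianReal_apply_eq_integral 0 one_ne_zero, ENNReal.toReal_ofReal]
  · simp only [ProbabilityTheory.gaussianPDFReal, gaussianCDF]
    rw [MeasureTheory.integral_const_mul]
    simp
  · exact MeasureTheory.integral_nonneg fun y => ProbabilityTheory.gaussianPDFReal_nonneg 0 1 y

/-- The distribution of `X` under the uniform probability on the finite set `S`, with the
convention `dirac 0` if `S` is empty. -/
noncomputable def uniformLaw {α : Type*} (S : Finset α) (X : α → ℝ) : MeasureTheory.Measure ℝ :=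
  open Classical in
  if S.Nonempty then (S.card : ENNReal)⁻¹ • ∑ l ∈ S, MeasureTheory.Measure.dirac (X l)
  else MeasureTheory.Measure.dirac 0

instance {α : Type*} (S : Finset α) (X : α → ℝ) :
    MeasureTheory.IsProbabilityMeasure (uniformLaw S X) := by
  unfold uniformLaw
  split_ifs with h
  · constructor
    simp only [MeasureTheory.Measure.smul_apply, MeasureTheory.Measure.finsetSum_apply,
      MeasureTheory.measure_univ, Finset.sum_const, smul_eq_mul, nsmul_eq_mul, mul_one]
    exact ENNReal.inv_mul_cancel (by exact_mod_cast h.card_pos.ne') (ENNReal.natCast_ne_top _)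
  · infer_instance

theorem charFun_uniformLaw {α : Type*} {S : Finset α} (hS : S.Nonempty) (X : α → ℝ) (t : ℝ) :
    MeasureTheory.charFun (uniformLaw S X) t =
      (∑ l ∈ S, Complex.exp (t * X l * Complex.I)) / S.card := by
  rw [MeasureTheory.charFun_apply_real, uniformLaw, if_pos hS,
    MeasureTheory.integral_smul_measure, MeasureTheory.integral_finsetSum_measure]
  · simp [div_eq_inv_mul]
  · intro l _
    exact MeasureTheory.integrable_dirac (by simp)

theorem uniformLaw_real_Iic {α : Type*} {S : Finset α} (hS : S.Nonempty) (X : α → ℝ) (x : ℝ) :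
    (uniformLaw S X).real (Set.Iic x) = ((S.filter fun l => X l ≤ x).card : ℝ) / S.card := by
  rw [MeasureTheory.measureReal_def, uniformLaw, if_pos hS, MeasureTheory.Measure.smul_apply,
    MeasureTheory.Measure.finsetSum_apply]
  have : ∀ l ∈ S, MeasureTheory.Measure.dirac (X l) (Set.Iic x) =
      if X l ≤ x then (1 : ENNReal) else 0 := by
    intro l _
    rw [MeasureTheory.Measure.dirac_apply' _ measurableSet_Iic, Set.indicator_apply]
    rfl
  rw [Finset.sum_congr rfl this, Finset.sum_boole, smul_eq_mul, ENNReal.toReal_mul,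
    ENNReal.toReal_inv, ENNReal.toReal_natCast, ENNReal.toReal_natCast, div_eq_inv_mul]

theorem tendsto_card_filter_div_gaussianCDF {α : Type*} (S : ℕ → Finset α) (X : ℕ → α → ℝ)
    (hchar : ∀ t : ℝ, Tendsto
      (fun n => (∑ l ∈ S n, Complex.exp (t * X n l * Complex.I)) / ((S n).card : ℂ)) atTop
      (𝓝 (Complex.exp (-(t ^ 2 / 2))))) (x : ℝ) :
    Tendsto (fun n => (((S n).filter fun l => X n l ≤ x).card : ℝ) / (S n).card) atTop
      (𝓝 (gaussianCDF x)) := by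
  have hne : ∀ᶠ n in atTop, (S n).Nonempty := by
    filter_upwards [(hchar 0).eventually_ne (Complex.exp_ne_zero _)] with n hn
    by_contra h
    rw [Finset.not_nonempty_iff_eq_empty] at h
    simp [h] at hn
  let ν : ℕ → MeasureTheory.ProbabilityMeasure ℝ := fun n => ⟨uniformLaw (S n) (X n), inferInstance⟩
  let γ : MeasureTheory.ProbabilityMeasure ℝ := ⟨ProbabilityTheory.gaussianReal 0 1, inferInstance⟩
  have hν : Tendsto ν atTop (𝓝 γ) := by
    refine MeasureTheory.ProbabilityMeasure.tendsto_of_tendsto_charFun fun t => ?_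
    have hγ : MeasureTheory.charFun (γ : MeasureTheory.Measure ℝ) t =
        Complex.exp (-(t ^ 2 / 2)) := by
      change MeasureTheory.charFun (ProbabilityTheory.gaussianReal 0 1) t = _
      rw [ProbabilityTheory.charFun_gaussianReal]
      simp
    rw [hγ]
    refine (hchar t).congr' ?_
    filter_upwards [hne] with n hn using (charFun_uniformLaw hn (X n) t).symm
  have hfr : γ (frontier (Set.Iic x)) = 0 := by
    rw [frontier_Iic, MeasureTheory.ProbabilityMeasure.null_iff_toMeasure_null]
    have := ProbabilityTheory.nullSingletonClass_gaussianReal (μ := 0) (v := 1) one_ne_zero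
    change (ProbabilityTheory.gaussianReal 0 1) {x} = 0
    exact MeasureTheory.measure_singleton x
  have hlim := (NNReal.tendsto_coe.2
    (MeasureTheory.ProbabilityMeasure.tendsto_measure_of_null_frontier_of_tendsto hν hfr))
  rw [gaussianCDF_eq]
  refine hlim.congr' ?_
  filter_upwards [hne] with n hn using uniformLaw_real_Iic hn (X n) x

theorem natCard_dyckCat_and (n : ℕ) (p : List ℤ → Prop) [DecidablePred p] :
    Nat.card {l : List ℤ // DyckCat n l ∧ p l} = ((dyckSuffixes n 0).filter p).card := by
  rw [← Nat.card_eq_finsetCard]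
  exact Nat.card_congr (Equiv.subtypeEquivRight fun l => by rw [Finset.mem_filter, dyckCat_iff])

theorem eCount_eq_card (n : ℕ) : eCount n = (dyckSuffixes n 0).card := by
  rw [eCount, ← Nat.card_eq_finsetCard]
  exact Nat.card_congr (Equiv.subtypeEquivRight fun l => dyckCat_iff n l)

/-- **Gaussian limit law for the number of catastrophes.** Let `μ` be the
unique real root of `31μ³ + 31μ² + 40μ - 3` and `σ > 0` the unique positive
real root of `29791σ⁶ - 59582σ⁴ + 60579σ² - 2927`. For every real `x`, the
fraction of Dyck paths with catastrophes of length `n` having at most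
`μn + σ√n·x` catastrophes tends to `Φ(x)`. -/
theorem catNum_gaussian (μ σ : ℝ)
    (hμ : 31 * μ ^ 3 + 31 * μ ^ 2 + 40 * μ - 3 = 0) (hσpos : 0 < σ)
    (hσ : 29791 * σ ^ 6 - 59582 * σ ^ 4 + 60579 * σ ^ 2 - 2927 = 0) (x : ℝ) :
    Tendsto (fun n : ℕ =>
        (Nat.card {l : List ℤ // DyckCat n l ∧
            (catNum dyckJ 0 l : ℝ) ≤ μ * n + σ * Real.sqrt n * x} : ℝ) /
          (eCount n : ℝ))
      atTop (𝓝 (gaussianCDF x)) := by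
  classical
  obtain ⟨c, h1, h2, hc⟩ := exists_root_cubic
  have hm := mean_eq_of_root hc hμ
  have hv := variance_eq_of_root (v := σ ^ 2) hc (by linear_combination hσ)
  have hA : (1 - (c : ℂ)) * (1 - c ^ 2) / (3 - 2 * c) ≠ 0 := by
    have : (1 - c) * (1 - c ^ 2) / (3 - 2 * c) ≠ 0 :=
      div_ne_zero (mul_ne_zero (by linarith) (by nlinarith)) (by linarith)
    exact_mod_cast this
  have hlam : ((c + c⁻¹ : ℝ) : ℂ) ≠ 0 := by
    have : 0 < c + c⁻¹ := by positivity
    exact_mod_cast this.ne'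
  set X : ℕ → List ℤ → ℝ := fun n l => (catNum dyckJ 0 l - μ * n) / (σ * √n) with hX
  have hchar : ∀ t : ℝ, Tendsto (fun n => (∑ l ∈ dyckSuffixes n 0,
      Complex.exp (t * X n l * Complex.I)) / ((dyckSuffixes n 0).card : ℂ)) atTop
      (𝓝 (Complex.exp (-(t ^ 2 / 2)))) := by
    intro t
    have k0 := tendsto_normalized_catPoly h1 h2 hc hm hv 0
    have k1 := (tendsto_normalized_catPoly h1 h2 hc hm hv (t / σ)).div k0
      (mul_ne_zero hA (Complex.exp_ne_zero _))
    rw [mul_div_mul_left _ _ hA] at k1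
    have hσC : (σ : ℂ) ≠ 0 := by exact_mod_cast hσpos.ne'
    have e1 : Complex.exp (-(((σ ^ 2 : ℝ) : ℂ) * ((t / σ : ℝ) : ℂ) ^ 2 / 2)) /
        Complex.exp (-(((σ ^ 2 : ℝ) : ℂ) * ((0 : ℝ) : ℂ) ^ 2 / 2)) =
        Complex.exp (-(t ^ 2 / 2)) := by
      rw [← Complex.exp_sub]
      push_cast
      congr 1
      field_simp
      ring
    rw [e1] at k1
    refine k1.congr fun n => ?_
    simp only [Pi.div_apply]
    have hcard : catPoly 1 n 0 = (dyckSuffixes n 0).card := by simp [catPoly]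
    simp only [Complex.ofReal_zero, zero_mul, zero_div, Complex.exp_zero, mul_zero, one_pow,
      mul_one, hcard]
    rw [div_div_div_cancel_right₀ (pow_ne_zero n hlam), catPoly, Finset.sum_mul]
    congr 1
    refine Finset.sum_congr rfl fun l _ => ?_
    rw [← Complex.exp_nat_mul, ← Complex.exp_nat_mul, ← Complex.exp_add, hX]
    congr 1
    push_cast
    rw [← div_div]
    ring
  refine (tendsto_card_filter_div_gaussianCDF (fun n => dyckSuffixes n 0) X hchar x).congr' ?_
  filter_upwards [eventually_gt_atTop 0] with n hn
  rw [natCard_dyckCat_and, eCount_eq_card]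
  congr 3
  ext l
  have hpos : 0 < σ * √(n : ℝ) := mul_pos hσpos (Real.sqrt_pos.2 (by exact_mod_cast hn))
  rw [hX, Finset.mem_filter, Finset.mem_filter, div_le_iff₀ hpos]
  constructor <;> rintro ⟨h3, h4⟩ <;> exact ⟨h3, by linarith⟩
end
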